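/- Let d ≥ 2, let μ be the Haar probability measure on the group U(d) of d×d unitary matrices, let ρ be a d×d Hermitian matrix with Tr[ρ] = 1, and let O be a d×d Hermitian matrix with Tr[O] = 0. Then ∫_{U(d)} (Tr[V ρ V† O])² dμ(V) = Tr[O²]·( Tr[ρ²]/(d² − 1) − 1/(d(d² − 1)) ). Consequently the variance of the model value Tr[VρV†O] over Haar-random V equals Tr[O²](Tr[ρ²] − 1/d)/(d² − 1), which for Tr[O²] ≤ d is O(1/d); hence the model outputs on Haar-random states concentrate around zero. (Second-moment Haar integral of Appendix F, establishing the exponential concentration that limits the conventional-experiment time-reversal classifier.) -/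

import Mathlib

open Matrix MeasureTheory

/-- Borel σ-algebra on the unitary group `U(d)` (as a subtype of the matrix space with
its natural topology). -/
noncomputable instance (d : ℕ) : MeasurableSpace (Matrix.unitaryGroup (Fin d) ℂ) :=
  borel _

instance (d : ℕ) : BorelSpace (Matrix.unitaryGroup (Fin d) ℂ) := ⟨rfl⟩

/-- The unitary rotating columns `j` and `l`: right multiplication by it replaces column `j` of `V`
by `(V_j + w V_l) / √2`. -/
noncomputable def planeRotation {d : ℕ} (j l : Fin d) (w : ℂ) : Matrix (Fin d) (Fin d) ℂ :=
  1 + (((√2)⁻¹ - 1 : ℝ) : ℂ) • (single j j 1 + single l l 1)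
    + (((√2)⁻¹ : ℝ) : ℂ) • (w • single l j 1 - star w • single j l 1)

lemma planeRotation_mem_unitaryGroup {d : ℕ} {j l : Fin d} (h : j ≠ l) {w : ℂ}
    (hw : star w * w = 1) :
    planeRotation j l w ∈ Matrix.unitaryGroup (Fin d) ℂ := by
  have hs : (((√2)⁻¹ : ℝ) : ℂ) * (((√2)⁻¹ : ℝ) : ℂ) = 1/2 := by
    rw [← Complex.ofReal_mul, ← mul_inv, Real.mul_self_sqrt (by norm_num)]; norm_num
  rw [Matrix.mem_unitaryGroup_iff']
  unfold planeRotation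
  push_cast at hs ⊢
  have hst : star (((√2:ℝ) : ℂ)⁻¹) = ((√2:ℝ) : ℂ)⁻¹ := by simp
  generalize (((√2:ℝ) : ℂ)⁻¹) = s at *
  have hP : (single j j (1:ℂ) + single l l 1) * (single j j (1:ℂ) + single l l 1)
      = single j j 1 + single l l 1 := by
    simp [mul_add, add_mul, h, h.symm]
  have hK : (w • single l j (1:ℂ) - star w • single j l 1)
      * (w • single l j (1:ℂ) - star w • single j l 1)
      = -(single j j 1 + single l l 1) := by
    have hw' : w * star w = 1 := by rw [mul_comm, hw]
    simp only [mul_sub, sub_mul, smul_mul_smul_comm, hw, hw', mul_one, single_mul_single_same,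
      single_mul_single_of_ne _ _ _ _ h, single_mul_single_of_ne _ _ _ _ h.symm]
    module
  have hPK : (single j j (1:ℂ) + single l l 1) * (w • single l j (1:ℂ) - star w • single j l 1)
      = w • single l j (1:ℂ) - star w • single j l 1 := by
    simp only [mul_sub, add_mul, mul_smul_comm, mul_one, single_mul_single_same,
      single_mul_single_of_ne _ _ _ _ h, single_mul_single_of_ne _ _ _ _ h.symm]
    module
  have hKP : (w • single l j (1:ℂ) - star w • single j l 1) * (single j j (1:ℂ) + single l l 1)
      = w • single l j (1:ℂ) - star w • single j l 1 := by
    simp only [sub_mul, mul_add, smul_mul_assoc, mul_one, single_mul_single_same,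
      single_mul_single_of_ne _ _ _ _ h, single_mul_single_of_ne _ _ _ _ h.symm]
    module
  have hP' : star (single j j (1:ℂ) + single l l 1) = single j j 1 + single l l 1 := by
    simp [star_eq_conjTranspose]
  have hK' : star (w • single l j (1:ℂ) - star w • single j l 1)
      = -(w • single l j (1:ℂ) - star w • single j l 1) := by
    simp [star_eq_conjTranspose, smul_single]
  generalize single j j (1:ℂ) + single l l 1 = P at *
  generalize w • single l j (1:ℂ) - star w • single j l 1 = K at *
  simp only [star_add, star_smul, star_one, star_sub, hP', hK', hst, mul_add, add_mul, one_mul,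
    mul_one, smul_mul_smul_comm, hP, hK, hPK, hKP, neg_mul, smul_neg]
  match_scalars <;> first | ring1 | linear_combination 2 * hs

lemma mul_planeRotation_apply {d : ℕ} {j l : Fin d} (h : j ≠ l) {w : ℂ}
    (V : Matrix (Fin d) (Fin d) ℂ) (i : Fin d) :
    (V * planeRotation j l w) i j = (((√2)⁻¹ : ℝ) : ℂ) * (V i j + w * V i l) := by
  simp [planeRotation, mul_add, mul_sub, h]
  ring

lemma mul_planeRotation_apply_of_ne {d : ℕ} {j l b : Fin d} (h : b ≠ j) (h' : b ≠ l) {w : ℂ}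
    (V : Matrix (Fin d) (Fin d) ℂ) (i : Fin d) :
    (V * planeRotation j l w) i b = V i b := by
  simp [planeRotation, mul_add, mul_sub, h, h']

/-- The squared modulus of an entry. -/
abbrev entrySq {d : ℕ} (V : Matrix (Fin d) (Fin d) ℂ) (i j : Fin d) : ℝ := Complex.normSq (V i j)

lemma normSq_inv_sqrt_two_mul (z : ℂ) : Complex.normSq ((((√2)⁻¹ : ℝ) : ℂ) * z) =
    Complex.normSq z / 2 := by
  rw [Complex.normSq_mul, Complex.normSq_ofReal, ← mul_inv, Real.mul_self_sqrt (by norm_num)]; ring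

lemma normSq_phase_average (x y : ℂ) :
    Complex.normSq (x + 1 * y) / 2 + Complex.normSq (x + (-1) * y) / 2
    = Complex.normSq x + Complex.normSq y := by
  simp [Complex.normSq_apply]; ring

lemma normSq_sq_phase_average (x y : ℂ) :
    (Complex.normSq (x + 1 * y) / 2) ^ 2 + (Complex.normSq (x + (-1) * y) / 2) ^ 2
    + (Complex.normSq (x + Complex.I * y) / 2) ^ 2 + (Complex.normSq (x + (-Complex.I) * y) / 2) ^ 2
    = Complex.normSq x ^ 2 + Complex.normSq y ^ 2 + 4 * (Complex.normSq x * Complex.normSq y) := by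
  simp [Complex.normSq_apply]; ring

section
variable {d : ℕ} {μ : Measure (Matrix.unitaryGroup (Fin d) ℂ)}

/-- Integrals of continuous functions are invariant under left and right translation. -/
def IsTranslationInvariant (μ : Measure (Matrix.unitaryGroup (Fin d) ℂ)) : Prop :=
  ∀ f : Matrix (Fin d) (Fin d) ℂ → ℝ, Continuous f → ∀ g h : Matrix.unitaryGroup (Fin d) ℂ,
    ∫ V : Matrix.unitaryGroup (Fin d) ℂ, f ((g : Matrix (Fin d) (Fin d) ℂ) * V * h) ∂μ =
    ∫ V : Matrix.unitaryGroup (Fin d) ℂ, f V ∂μ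

lemma IsTranslationInvariant.right (hμ : IsTranslationInvariant μ)
    {f : Matrix (Fin d) (Fin d) ℂ → ℝ} (hf : Continuous f)
    {j l : Fin d} (h : j ≠ l) {w : ℂ} (hw : star w * w = 1) :
    ∫ V : Matrix.unitaryGroup (Fin d) ℂ, f (V * planeRotation j l w) ∂μ =
      ∫ V : Matrix.unitaryGroup (Fin d) ℂ, f V ∂μ := by
  simpa using hμ f hf 1 ⟨_, planeRotation_mem_unitaryGroup h hw⟩

lemma IsTranslationInvariant.left (hμ : IsTranslationInvariant μ)
    {f : Matrix (Fin d) (Fin d) ℂ → ℝ} (hf : Continuous f)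
    {j l : Fin d} (h : j ≠ l) {w : ℂ} (hw : star w * w = 1) :
    ∫ V : Matrix.unitaryGroup (Fin d) ℂ, f ((planeRotation j l w)ᵀ * V) ∂μ =
      ∫ V : Matrix.unitaryGroup (Fin d) ℂ, f V ∂μ := by
  simpa using hμ f hf ⟨_, transpose_mem_unitaryGroup_iff.mpr (planeRotation_mem_unitaryGroup h hw)⟩ 1

lemma isTranslationInvariant_of_map_eq
    (hLeft : ∀ g : Matrix.unitaryGroup (Fin d) ℂ, Measure.map (fun x => g * x) μ = μ)
    (hRight : ∀ g : Matrix.unitaryGroup (Fin d) ℂ, Measure.map (fun x => x * g) μ = μ) :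
    IsTranslationInvariant μ := fun f hf g h => by
  have hc : Continuous (fun V : Matrix.unitaryGroup (Fin d) ℂ => f V) := by fun_prop
  conv_rhs => rw [← hRight h, integral_map (by fun_prop) hc.aestronglyMeasurable, ← hLeft g,
    integral_map (by fun_prop) (Continuous.aestronglyMeasurable (by fun_prop))]
  rfl

variable [IsProbabilityMeasure μ]

lemma integrable_of_continuous {f : Matrix (Fin d) (Fin d) ℂ → ℝ} (hf : Continuous f) :
    Integrable (fun V : Matrix.unitaryGroup (Fin d) ℂ => f V) μ := by
  have : CompactSpace (Matrix.unitaryGroup (Fin d) ℂ) := by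
    have hcl : IsClosed (unitaryGroup (Fin d) ℂ : Set (Matrix (Fin d) (Fin d) ℂ)) := isClosed_unitary
    refine isCompact_iff_compactSpace.1 (IsCompact.of_isClosed_subset
      (isCompact_univ_pi fun _ => isCompact_univ_pi fun _ => isCompact_closedBall (0 : ℂ) 1) hcl ?_)
    intro V hV i _ j _
    simpa using entry_norm_bound_of_unitary hV i j
  have hc : Continuous (fun V : Matrix.unitaryGroup (Fin d) ℂ => f V) := by fun_prop
  exact hc.integrable_of_hasCompactSupport (HasCompactSupport.of_compactSpace _)

lemma continuous_entrySq (i j : Fin d) :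
    Continuous (fun V : Matrix (Fin d) (Fin d) ℂ => entrySq V i j) := by
  unfold entrySq; fun_prop

lemma sum_entrySq_row (V : Matrix.unitaryGroup (Fin d) ℂ) (i : Fin d) :
    ∑ j, entrySq (V : Matrix (Fin d) (Fin d) ℂ) i j = 1 := by
  have h := congrFun₂ (Matrix.mem_unitaryGroup_iff.1 V.2) i i
  rw [Matrix.mul_apply] at h
  simp only [star_apply, one_apply_eq] at h
  simp only [← starRingEnd_apply, Complex.mul_conj] at h
  exact_mod_cast h

lemma entrySq_mul_planeRotation {j l : Fin d} (h : j ≠ l) (w : ℂ) (V : Matrix (Fin d) (Fin d) ℂ)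
    (i : Fin d) :
    entrySq (V * planeRotation j l w) i j = Complex.normSq (V i j + w * V i l) / 2 := by
  rw [entrySq, mul_planeRotation_apply h, normSq_inv_sqrt_two_mul]

lemma entrySq_planeRotation_mul {j l : Fin d} (h : j ≠ l) (w : ℂ) (V : Matrix (Fin d) (Fin d) ℂ)
    (i : Fin d) :
    entrySq ((planeRotation j l w)ᵀ * V) j i = Complex.normSq (V j i + w * V l i) / 2 := by
  have := entrySq_mul_planeRotation h w Vᵀ i
  rwa [show (planeRotation j l w)ᵀ * V = (Vᵀ * planeRotation j l w)ᵀ by simp]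

lemma integral_entrySq_eq_of_row (hμ : IsTranslationInvariant μ) (i j l : Fin d) :
    ∫ V : Matrix.unitaryGroup (Fin d) ℂ, entrySq V i j ∂μ =
      ∫ V : Matrix.unitaryGroup (Fin d) ℂ, entrySq V i l ∂μ := by
  rcases eq_or_ne j l with rfl | h
  · rfl
  have e1 := hμ.right (continuous_entrySq i j) h (w := 1) (by simp)
  have e2 := hμ.right (continuous_entrySq i j) h (w := -1) (by simp)
  have key : ∫ V : Matrix.unitaryGroup (Fin d) ℂ, (entrySq (V.1 * planeRotation j l 1) i j
        + entrySq (V.1 * planeRotation j l (-1)) i j) ∂μ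
      = ∫ V : Matrix.unitaryGroup (Fin d) ℂ, (entrySq V i j + entrySq V i l) ∂μ := by
    congr 1; ext V
    rw [entrySq_mul_planeRotation h, entrySq_mul_planeRotation h, normSq_phase_average]
  have c := @continuous_entrySq d
  rw [integral_add (integrable_of_continuous
      (f := fun V => entrySq (V * planeRotation j l 1) i j)
      ((c _ _).comp (by fun_prop)))
    (integrable_of_continuous
      (f := fun V => entrySq (V * planeRotation j l (-1)) i j)
      ((c _ _).comp (by fun_prop))),
    integral_add (integrable_of_continuous (c _ _)) (integrable_of_continuous (c _ _)),
    e1, e2] at key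
  linarith

lemma integral_entrySq_mul_eq_of_row (hμ : IsTranslationInvariant μ) {i j k l b : Fin d}
    (hj : b ≠ j) (hl : b ≠ l) :
    ∫ V : Matrix.unitaryGroup (Fin d) ℂ, entrySq V i b * entrySq V k j ∂μ =
      ∫ V : Matrix.unitaryGroup (Fin d) ℂ, entrySq V i b * entrySq V k l ∂μ := by
  rcases eq_or_ne j l with rfl | h
  · rfl
  have c := @continuous_entrySq d
  have c2 : Continuous fun V : Matrix (Fin d) (Fin d) ℂ => entrySq V i b * entrySq V k j :=
    (c _ _).mul (c _ _)
  have e1 := hμ.right c2 h (w := 1) (by simp)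
  have e2 := hμ.right c2 h (w := -1) (by simp)
  have key : ∫ V : Matrix.unitaryGroup (Fin d) ℂ,
        (entrySq (V.1 * planeRotation j l 1) i b * entrySq (V.1 * planeRotation j l 1) k j
        + entrySq (V.1 * planeRotation j l (-1)) i b * entrySq (V.1 * planeRotation j l (-1)) k j) ∂μ
      = ∫ V : Matrix.unitaryGroup (Fin d) ℂ, (entrySq V i b * entrySq V k j
        + entrySq V i b * entrySq V k l) ∂μ := by
    congr 1; ext V
    rw [entrySq_mul_planeRotation h, entrySq_mul_planeRotation h]
    simp only [entrySq, mul_planeRotation_apply_of_ne hj hl]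
    rw [← mul_add, ← mul_add, normSq_phase_average]
  rw [integral_add (integrable_of_continuous
      (f := fun V => entrySq (V * planeRotation j l 1) i b *
        entrySq (V * planeRotation j l 1) k j)
      (c2.comp (by fun_prop)))
    (integrable_of_continuous
      (f := fun V => entrySq (V * planeRotation j l (-1)) i b *
        entrySq (V * planeRotation j l (-1)) k j)
      (c2.comp (by fun_prop))),
    integral_add (integrable_of_continuous c2)
      (integrable_of_continuous (f := fun V => entrySq V i b * entrySq V k l)
        ((c _ _).mul (c _ _))),
    e1, e2] at key
  linarith

/-- If four continuous functions have equal integrals and average to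
`(x² + y² + 4xy) / 4`, the integrals of `x²`, `y²` and `xy` are related accordingly. -/
lemma integral_phase_average {f₁ f₂ f₃ f₄ x y : Matrix (Fin d) (Fin d) ℂ → ℝ}
    (h₁ : Continuous f₁) (h₂ : Continuous f₂) (h₃ : Continuous f₃) (h₄ : Continuous f₄)
    (hx : Continuous x) (hy : Continuous y) {a : ℝ}
    (i₁ : ∫ V : Matrix.unitaryGroup (Fin d) ℂ, f₁ V ∂μ = a)
    (i₂ : ∫ V : Matrix.unitaryGroup (Fin d) ℂ, f₂ V ∂μ = a)
    (i₃ : ∫ V : Matrix.unitaryGroup (Fin d) ℂ, f₃ V ∂μ = a)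
    (i₄ : ∫ V : Matrix.unitaryGroup (Fin d) ℂ, f₄ V ∂μ = a)
    (h : ∀ V, f₁ V + f₂ V + f₃ V + f₄ V = x V ^ 2 + y V ^ 2 + 4 * (x V * y V)) :
    4 * a = ∫ V : Matrix.unitaryGroup (Fin d) ℂ, x V ^ 2 ∂μ
      + ∫ V : Matrix.unitaryGroup (Fin d) ℂ, y V ^ 2 ∂μ
      + 4 * ∫ V : Matrix.unitaryGroup (Fin d) ℂ, x V * y V ∂μ := by
  have key : ∫ V : Matrix.unitaryGroup (Fin d) ℂ, (f₁ V + f₂ V + f₃ V + f₄ V) ∂μ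
      = ∫ V : Matrix.unitaryGroup (Fin d) ℂ, (x V ^ 2 + y V ^ 2 + 4 * (x V * y V)) ∂μ := by
    simp_rw [h]
  rw [integral_add (integrable_of_continuous (f := fun V => f₁ V + f₂ V + f₃ V) (by fun_prop))
      (integrable_of_continuous h₄),
    integral_add (integrable_of_continuous (f := fun V => f₁ V + f₂ V) (by fun_prop))
      (integrable_of_continuous h₃),
    integral_add (integrable_of_continuous h₁) (integrable_of_continuous h₂),
    integral_add (integrable_of_continuous (f := fun V => x V ^ 2 + y V ^ 2) (by fun_prop))
      (integrable_of_continuous (f := fun V => 4 * (x V * y V)) (by fun_prop)),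
    integral_add (integrable_of_continuous (f := fun V => x V ^ 2) (by fun_prop))
      (integrable_of_continuous (f := fun V => y V ^ 2) (by fun_prop)),
    integral_const_mul, i₁, i₂, i₃, i₄] at key
  linarith

lemma integral_entrySq_sq_row (hμ : IsTranslationInvariant μ) (i : Fin d) {j l : Fin d}
    (h : j ≠ l) :
    4 * ∫ V : Matrix.unitaryGroup (Fin d) ℂ, entrySq V i j ^ 2 ∂μ =
      ∫ V : Matrix.unitaryGroup (Fin d) ℂ, entrySq V i j ^ 2 ∂μ
      + ∫ V : Matrix.unitaryGroup (Fin d) ℂ, entrySq V i l ^ 2 ∂μ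
      + 4 * ∫ V : Matrix.unitaryGroup (Fin d) ℂ, entrySq V i j * entrySq V i l ∂μ := by
  have c2 : Continuous fun V : Matrix (Fin d) (Fin d) ℂ => entrySq V i j ^ 2 :=
    (continuous_entrySq _ _).pow 2
  have cr (w : ℂ) :
      Continuous fun V : Matrix (Fin d) (Fin d) ℂ => entrySq (V * planeRotation j l w) i j ^ 2 :=
    c2.comp (by fun_prop)
  refine integral_phase_average (cr _) (cr _) (cr _) (cr _)
    (continuous_entrySq i j) (continuous_entrySq i l)
    (hμ.right c2 h (w := 1) (by simp)) (hμ.right c2 h (w := -1) (by simp))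
    (hμ.right c2 h (w := Complex.I) (by simp)) (hμ.right c2 h (w := -Complex.I) (by simp))
    fun V => ?_
  simp only [entrySq_mul_planeRotation h]
  exact normSq_sq_phase_average _ _

lemma integral_entrySq_sq_col (hμ : IsTranslationInvariant μ) (i : Fin d) {j l : Fin d}
    (h : j ≠ l) :
    4 * ∫ V : Matrix.unitaryGroup (Fin d) ℂ, entrySq V j i ^ 2 ∂μ =
      ∫ V : Matrix.unitaryGroup (Fin d) ℂ, entrySq V j i ^ 2 ∂μ
      + ∫ V : Matrix.unitaryGroup (Fin d) ℂ, entrySq V l i ^ 2 ∂μ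
      + 4 * ∫ V : Matrix.unitaryGroup (Fin d) ℂ, entrySq V j i * entrySq V l i ∂μ := by
  have c2 : Continuous fun V : Matrix (Fin d) (Fin d) ℂ => entrySq V j i ^ 2 :=
    (continuous_entrySq _ _).pow 2
  have cr (w : ℂ) :
      Continuous fun V : Matrix (Fin d) (Fin d) ℂ => entrySq ((planeRotation j l w)ᵀ * V) j i ^ 2 :=
    c2.comp (by fun_prop)
  refine integral_phase_average (cr _) (cr _) (cr _) (cr _)
    (continuous_entrySq j i) (continuous_entrySq l i)
    (hμ.left c2 h (w := 1) (by simp)) (hμ.left c2 h (w := -1) (by simp))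
    (hμ.left c2 h (w := Complex.I) (by simp)) (hμ.left c2 h (w := -Complex.I) (by simp))
    fun V => ?_
  simp only [entrySq_planeRotation_mul h]
  exact normSq_sq_phase_average _ _

lemma sum_eq_of_ne (f : Fin d → ℝ) (j : Fin d) {c : ℝ} (h : ∀ l, l ≠ j → f l = c) :
    ∑ l, f l = f j + (d - 1) * c := by
  have : ∀ l, f l = c + if l = j then f j - c else 0 := by
    intro l
    split_ifs with hl
    · rw [hl]; ring
    · rw [h l hl, add_zero]
  rw [Finset.sum_congr rfl fun l _ => this l, Finset.sum_add_distrib]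
  simp
  ring

lemma integral_entrySq (hd : 2 ≤ d) (hμ : IsTranslationInvariant μ) (i j : Fin d) :
    ∫ V : Matrix.unitaryGroup (Fin d) ℂ, entrySq V i j ∂μ = 1 / d := by
  have h : ∑ l, ∫ V : Matrix.unitaryGroup (Fin d) ℂ, entrySq V i l ∂μ = 1 := by
    rw [← integral_finsetSum _ fun l _ => integrable_of_continuous
    (continuous_entrySq i l)]
    simp [sum_entrySq_row]
  rw [Finset.sum_congr rfl fun l _ => integral_entrySq_eq_of_row hμ i l j] at h
  have : (d : ℝ) ≠ 0 := by positivity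
  simp at h
  field_simp
  linarith

lemma sum_integral_entrySq_mul (hd : 2 ≤ d) (hμ : IsTranslationInvariant μ) (i j k : Fin d) :
    ∑ l, ∫ V : Matrix.unitaryGroup (Fin d) ℂ, entrySq V i j * entrySq V k l ∂μ = 1 / d := by
  rw [← integral_finsetSum _ fun l _ => integrable_of_continuous
    (f := fun V => entrySq V i j * entrySq V k l)
    ((continuous_entrySq i j).mul (continuous_entrySq k l)), ← integral_entrySq hd hμ i j]
  simp [← Finset.mul_sum, sum_entrySq_row]

lemma integral_entrySq_mul_row (hμ : IsTranslationInvariant μ) (i : Fin d) {j l : Fin d}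
    (h : j ≠ l) :
    ∫ V : Matrix.unitaryGroup (Fin d) ℂ, entrySq V i j * entrySq V i l ∂μ =
      (∫ V : Matrix.unitaryGroup (Fin d) ℂ, entrySq V i j ^ 2 ∂μ) / 2 := by
  have h1 := integral_entrySq_sq_row hμ i h
  have h2 := integral_entrySq_sq_row hμ i h.symm
  simp only [mul_comm (entrySq _ i l)] at h2
  linarith

lemma integral_entrySq_mul_col (hμ : IsTranslationInvariant μ) (i : Fin d) {j l : Fin d}
    (h : j ≠ l) :
    ∫ V : Matrix.unitaryGroup (Fin d) ℂ, entrySq V j i * entrySq V l i ∂μ =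
      (∫ V : Matrix.unitaryGroup (Fin d) ℂ, entrySq V j i ^ 2 ∂μ) / 2 := by
  have h1 := integral_entrySq_sq_col hμ i h
  have h2 := integral_entrySq_sq_col hμ i h.symm
  simp only [mul_comm (entrySq _ l i)] at h2
  linarith

lemma integral_entrySq_sq (hd : 2 ≤ d) (hμ : IsTranslationInvariant μ) (i j : Fin d) :
    ∫ V : Matrix.unitaryGroup (Fin d) ℂ, entrySq V i j ^ 2 ∂μ = 2 / (d * (d + 1)) := by
  have h := sum_integral_entrySq_mul hd hμ i j i
  rw [sum_eq_of_ne _ j fun l hl => integral_entrySq_mul_row hμ i hl.symm] at h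
  simp only [← sq] at h
  have : (d : ℝ) ≠ 0 := by positivity
  have : (d : ℝ) + 1 ≠ 0 := by positivity
  field_simp at h ⊢
  linarith

lemma integral_entrySq_mul (hd : 2 ≤ d) (hμ : IsTranslationInvariant μ) (i j k l : Fin d) :
    ∫ V : Matrix.unitaryGroup (Fin d) ℂ, entrySq V i j * entrySq V k l ∂μ =
      1 / ((d : ℝ) ^ 2 - 1) - (if i = k then 1 / (d * ((d : ℝ) ^ 2 - 1)) else 0)
        - (if j = l then 1 / (d * ((d : ℝ) ^ 2 - 1)) else 0)
        + if i = k then if j = l then 1 / ((d : ℝ) ^ 2 - 1) else 0 else 0 := by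
  have hd' : (2 : ℝ) ≤ d := by exact_mod_cast hd
  have h0 : (d : ℝ) ≠ 0 := by positivity
  have h1 : (d : ℝ) + 1 ≠ 0 := by positivity
  have h2 : (d : ℝ) - 1 ≠ 0 := by linarith
  rw [show (d : ℝ) ^ 2 - 1 = (d - 1) * (d + 1) by ring]
  by_cases hik : i = k <;> by_cases hjl : j = l
  · subst hik hjl
    simp only [← sq, integral_entrySq_sq hd hμ, if_true]
    field_simp
    ring
  · subst hik
    simp only [integral_entrySq_mul_row hμ i hjl, integral_entrySq_sq hd hμ, if_true, hjl, if_false]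
    field_simp
    ring
  · subst hjl
    simp only [integral_entrySq_mul_col hμ j hik, integral_entrySq_sq hd hμ, if_true, hik, if_false]
    field_simp
    ring
  · have h := sum_integral_entrySq_mul hd hμ i j k
    rw [sum_eq_of_ne _ j fun b hb =>
        integral_entrySq_mul_eq_of_row hμ (i := i) (k := k) hb.symm hjl,
      integral_entrySq_mul_col hμ j hik, integral_entrySq_sq hd hμ] at h
    simp only [hik, hjl, if_false]
    generalize ∫ V : Matrix.unitaryGroup (Fin d) ℂ, entrySq V i j * entrySq V k l ∂μ = c at *
    field_simp at h ⊢
    apply mul_left_cancel₀ h0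
    linear_combination h

lemma integral_sum_entrySq (hd : 2 ≤ d) (hμ : IsTranslationInvariant μ) (p q : Fin d → ℝ) :
    ∫ V : Matrix.unitaryGroup (Fin d) ℂ, ∑ i, ∑ j, q i * p j * entrySq V i j ∂μ
      = (∑ i, q i) * (∑ j, p j) / d := by
  have c (i j) : Continuous fun V : Matrix (Fin d) (Fin d) ℂ => q i * p j * entrySq V i j :=
    continuous_const.mul (continuous_entrySq i j)
  rw [integral_finsetSum _ fun i _ => integrable_of_continuous
    (f := fun V => ∑ j, q i * p j * entrySq V i j) (by fun_prop)]
  rw [Finset.sum_mul_sum, Finset.sum_div]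
  refine Finset.sum_congr rfl fun i _ => ?_
  rw [integral_finsetSum _ fun j _ => integrable_of_continuous (c i j), Finset.sum_div]
  refine Finset.sum_congr rfl fun j _ => ?_
  rw [integral_const_mul, integral_entrySq hd hμ]
  ring

lemma sum_pair_mul (a b : Fin d → Fin d → ℝ) :
    ∑ x : (Fin d × Fin d) × (Fin d × Fin d), a x.1.1 x.2.1 * b x.1.2 x.2.2 =
      (∑ i, ∑ k, a i k) * ∑ j, ∑ l, b j l := by
  rw [← Fintype.sum_prod_type', ← Fintype.sum_prod_type', Finset.sum_mul_sum,
    ← Fintype.sum_prod_type']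
  exact Fintype.sum_equiv (Equiv.prodProdProdComm _ _ _ _) _ _ fun _ => rfl

lemma integral_sum_entrySq_sq (hd : 2 ≤ d) (hμ : IsTranslationInvariant μ) (p q : Fin d → ℝ)
    (hp : ∑ j, p j = 1)
    (hq : ∑ i, q i = 0) :
    ∫ V : Matrix.unitaryGroup (Fin d) ℂ, (∑ i, ∑ j, q i * p j * entrySq V i j) ^ 2 ∂μ
      = (∑ i, q i ^ 2) * ((∑ j, p j ^ 2) / ((d : ℝ) ^ 2 - 1) - 1 / (d * ((d : ℝ) ^ 2 - 1))) := by
  have c (x : (Fin d × Fin d) × (Fin d × Fin d)) : Continuous fun V : Matrix (Fin d) (Fin d) ℂ =>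
      q x.1.1 * p x.1.2 * (q x.2.1 * p x.2.2) * (entrySq V x.1.1 x.1.2 * entrySq V x.2.1 x.2.2) :=
    continuous_const.mul ((continuous_entrySq _ _).mul (continuous_entrySq _ _))
  have e (V : Matrix (Fin d) (Fin d) ℂ) : (∑ i, ∑ j, q i * p j * entrySq V i j) ^ 2 =
      ∑ x : (Fin d × Fin d) × (Fin d × Fin d),
        q x.1.1 * p x.1.2 * (q x.2.1 * p x.2.2) * (entrySq V x.1.1 x.1.2 * entrySq V x.2.1 x.2.2) := by
    rw [← Fintype.sum_prod_type', sq, Finset.sum_mul_sum, ← Fintype.sum_prod_type']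
    exact Finset.sum_congr rfl fun _ _ => by ring
  simp_rw [e]
  rw [integral_finsetSum _ fun x _ => integrable_of_continuous (c x)]
  simp_rw [integral_const_mul, integral_entrySq_mul hd hμ]
  rw [div_eq_mul_one_div (∑ j, p j ^ 2)]
  generalize 1 / ((d : ℝ) ^ 2 - 1) = u
  generalize 1 / ((d : ℝ) * ((d : ℝ) ^ 2 - 1)) = v
  have s (r : Fin d → ℝ) : ∑ i, ∑ k, r i * r k = (∑ i, r i) ^ 2 := by
    rw [sq, Finset.sum_mul_sum]
  have t (r : Fin d → ℝ) : (∑ i, ∑ k, if i = k then r i * r k else 0) = ∑ i, r i ^ 2 := by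
    simp [sq]
  have h₁ := sum_pair_mul (fun i k => q i * q k) (fun j l => p j * p l)
  have h₂ := sum_pair_mul (fun i k => if i = k then q i * q k else 0) (fun j l => p j * p l)
  have h₃ := sum_pair_mul (fun i k => q i * q k) (fun j l => if j = l then p j * p l else 0)
  have h₄ := sum_pair_mul (fun i k => if i = k then q i * q k else 0)
    (fun j l => if j = l then p j * p l else 0)
  rw [s, s, hp, hq] at h₁
  rw [t, s, hp] at h₂
  rw [s, t, hq] at h₃
  rw [t, t] at h₄
  trans (u * ((0 : ℝ) ^ 2 * 1 ^ 2) - v * ((∑ i, q i ^ 2) * 1 ^ 2) - v * (0 ^ 2 * ∑ j, p j ^ 2)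
    + u * ((∑ i, q i ^ 2) * ∑ j, p j ^ 2))
  · rw [← h₁, ← h₂, ← h₃, ← h₄]
    simp only [Finset.mul_sum, ← Finset.sum_add_distrib, ← Finset.sum_sub_distrib]
    refine Finset.sum_congr rfl fun x _ => ?_
    split_ifs <;> ring
  · ring

lemma trace_diagonal_conj (V : Matrix (Fin d) (Fin d) ℂ) (p q : Fin d → ℝ) :
    (V * diagonal (fun i => (p i : ℂ)) * Vᴴ * diagonal (fun i => (q i : ℂ))).trace
      = ((∑ i, ∑ j, q i * p j * entrySq V i j : ℝ) : ℂ) := by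
  simp only [trace, diag_apply, mul_diagonal, mul_apply (M := V * _), conjTranspose_apply]
  push_cast
  refine Finset.sum_congr rfl fun i _ => ?_
  rw [Finset.sum_mul]
  refine Finset.sum_congr rfl fun j _ => ?_
  rw [← Complex.mul_conj, starRingEnd_apply]
  ring

lemma exists_unitary_diagonalization {A : Matrix (Fin d) (Fin d) ℂ} (hA : Aᴴ = A) :
    ∃ (U : Matrix.unitaryGroup (Fin d) ℂ) (p : Fin d → ℝ),
      A = U * diagonal (fun i => (p i : ℂ)) * (U : Matrix (Fin d) (Fin d) ℂ)ᴴ ∧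
      A.trace = ((∑ i, p i : ℝ) : ℂ) ∧ (A * A).trace = ((∑ i, p i ^ 2 : ℝ) : ℂ) := by
  have hA' : A.IsHermitian := hA
  have h := hA'.spectral_theorem
  rw [Unitary.conjStarAlgAut_apply] at h
  refine ⟨hA'.eigenvectorUnitary, hA'.eigenvalues, h, ?_, ?_⟩
  · rw [hA'.trace_eq_sum_eigenvalues]; simp
  · generalize hA'.eigenvectorUnitary = U at h
    generalize hA'.eigenvalues = p at h ⊢
    have hU : star (U : Matrix (Fin d) (Fin d) ℂ) * U = 1 := Unitary.coe_star_mul_self U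
    rw [h, trace_mul_comm]
    generalize (U : Matrix (Fin d) (Fin d) ℂ) = W at *
    rw [mul_assoc, mul_assoc, trace_mul_comm]
    simp only [mul_assoc, hU, mul_one]
    simp only [← mul_assoc (star W), hU, one_mul, diagonal_mul_diagonal, trace_diagonal]
    simp [sq]

lemma integral_trace_conj (hd : 2 ≤ d) (hμ : IsTranslationInvariant μ)
    {ρ O : Matrix (Fin d) (Fin d) ℂ}
    (hρ : ρᴴ = ρ) (hρtr : ρ.trace = 1) (hOherm : Oᴴ = O) (hOtr : O.trace = 0) :
    (∫ V : Matrix.unitaryGroup (Fin d) ℂ,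
        ((V : Matrix (Fin d) (Fin d) ℂ) * ρ * (V : Matrix (Fin d) (Fin d) ℂ)ᴴ * O).trace ∂μ) = 0 ∧
    (∫ V : Matrix.unitaryGroup (Fin d) ℂ,
        ((V : Matrix (Fin d) (Fin d) ℂ) * ρ * (V : Matrix (Fin d) (Fin d) ℂ)ᴴ * O).trace ^ 2 ∂μ)
      = (O * O).trace * ((ρ * ρ).trace / ((d : ℂ) ^ 2 - 1)
          - 1 / ((d : ℂ) * ((d : ℂ) ^ 2 - 1))) := by
  obtain ⟨U, p, hU, hp, hp2⟩ := exists_unitary_diagonalization hρ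
  obtain ⟨W, q, hW, hq, hq2⟩ := exists_unitary_diagonalization hOherm
  rw [hρtr] at hp
  rw [hOtr] at hq
  have hp' : ∑ i, p i = 1 := by exact_mod_cast hp.symm
  have hq' : ∑ i, q i = 0 := by exact_mod_cast hq.symm
  set F : Matrix (Fin d) (Fin d) ℂ → ℝ := fun V => ∑ i, ∑ j, q i * p j * entrySq V i j with hF
  have hFc : Continuous F := continuous_finsetSum _ fun i _ => continuous_finsetSum _ fun j _ =>
    continuous_const.mul (continuous_entrySq i j)
  have key (V : Matrix (Fin d) (Fin d) ℂ) : (V * ρ * Vᴴ * O).trace =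
      F (((W⁻¹ : Matrix.unitaryGroup (Fin d) ℂ) : Matrix (Fin d) (Fin d) ℂ) * V * U) := by
    rw [hF, ← trace_diagonal_conj, hU, hW]
    simp only [UnitaryGroup.inv_val, star_eq_conjTranspose, conjTranspose_mul,
      conjTranspose_conjTranspose, ← mul_assoc]
    rw [trace_mul_comm]
    simp only [mul_assoc]
  simp_rw [key]
  rw [hp2, hq2]
  constructor
  · rw [integral_complex_ofReal, hμ F hFc, integral_sum_entrySq hd hμ, hq']
    simp
  · simp_rw [← Complex.ofReal_pow]
    rw [integral_complex_ofReal, hμ (fun V => F V ^ 2) (hFc.pow 2),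
      integral_sum_entrySq_sq hd hμ p q hp' hq']
    push_cast
    rfl

end

/-- **Second-moment Haar integral (Appendix F).** Let `d ≥ 2`, let `μ` be the Haar
probability measure on `U(d)`, let `ρ` be Hermitian with `Tr[ρ] = 1` and `O` Hermitian
with `Tr[O] = 0`.  Then
`∫ (Tr[VρV†O])² dμ(V) = Tr[O²]·(Tr[ρ²]/(d²−1) − 1/(d(d²−1)))`, and consequently the
variance of the model value over Haar-random `V` equals
`Tr[O²](Tr[ρ²] − 1/d)/(d²−1)`: the model outputs on Haar-random states concentrate
around zero. -/
theorem stmt_19 {d : ℕ} (hd : 2 ≤ d)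
    (μ : Measure (Matrix.unitaryGroup (Fin d) ℂ)) [IsProbabilityMeasure μ]
    (hLeft : ∀ g : Matrix.unitaryGroup (Fin d) ℂ,
      Measure.map (fun x => g * x) μ = μ)
    (hRight : ∀ g : Matrix.unitaryGroup (Fin d) ℂ,
      Measure.map (fun x => x * g) μ = μ)
    (ρ O : Matrix (Fin d) (Fin d) ℂ)
    (hρ : ρᴴ = ρ) (hρtr : ρ.trace = 1) (hOherm : Oᴴ = O) (hOtr : O.trace = 0) :
    (∫ V : Matrix.unitaryGroup (Fin d) ℂ,
        ((V : Matrix (Fin d) (Fin d) ℂ) * ρ * (V : Matrix (Fin d) (Fin d) ℂ)ᴴ * O).trace ^ 2 ∂μ)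
      = (O * O).trace * ((ρ * ρ).trace / ((d : ℂ) ^ 2 - 1)
          - 1 / ((d : ℂ) * ((d : ℂ) ^ 2 - 1))) ∧
    (∫ V : Matrix.unitaryGroup (Fin d) ℂ,
        ((V : Matrix (Fin d) (Fin d) ℂ) * ρ * (V : Matrix (Fin d) (Fin d) ℂ)ᴴ * O).trace ^ 2 ∂μ)
      - (∫ V : Matrix.unitaryGroup (Fin d) ℂ,
          ((V : Matrix (Fin d) (Fin d) ℂ) * ρ * (V : Matrix (Fin d) (Fin d) ℂ)ᴴ * O).trace ∂μ) ^ 2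
      = (O * O).trace * ((ρ * ρ).trace - 1 / d) / ((d : ℂ) ^ 2 - 1) := by
  obtain ⟨h₁, h₂⟩ := integral_trace_conj hd (isTranslationInvariant_of_map_eq hLeft hRight)
    hρ hρtr hOherm hOtr
  refine ⟨h₂, ?_⟩
  rw [h₁, h₂, ← div_div]
  ring
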